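/- Let d = 39028039587479. Then d is prime, d ≡ 3 (mod 4), and every fundamental solution a of the Pell equation x² − d·y² = 1 satisfies d ∣ a.y. (This is the counterexample to Mordell's Pellian Equation Conjecture.) -/

import Mathlib

/-- The form `A X² + 2 B X Y + A C Y²` represents `1` at a point whose coordinates have known
residues modulo `m` and are bounded by `2 ^ L`. -/
def PellRep (m A B C w0 v0 : ℤ) (L : ℕ) : Prop :=
  ∃ w v : ℤ, A * w ^ 2 + 2 * B * w * v + A * C * v ^ 2 = 1 ∧ w ≡ w0 [ZMOD m] ∧ v ≡ v0 [ZMOD m] ∧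
    |w| ≤ 2 ^ L ∧ |v| ≤ 2 ^ L

lemma bound_aux (a b X Y N c K : ℤ) (hX : |X| ≤ N * c) (hY : |Y| ≤ N * c) (hN : 0 ≤ N)
    (h : (|a| + |b|) * c ≤ K) : |a * X - b * Y| ≤ N * K := by
  calc |a * X - b * Y| ≤ |a * X| + |b * Y| := abs_sub _ _
    _ = |a| * |X| + |b| * |Y| := by rw [abs_mul, abs_mul]
    _ ≤ |a| * (N * c) + |b| * (N * c) := by gcongr
    _ = N * ((|a| + |b|) * c) := by ring
    _ ≤ N * K := by gcongr

/-- Square the form (Dirichlet composition), then change variables by a matrix in `SL₂(ℤ)`. -/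
lemma PellRep.step {m A B C w0 v0 : ℤ} {L : ℕ} (h : PellRep m A B C w0 v0 L)
    (A' B' C' p q r t w1 v1 : ℤ) (K L' : ℕ)
    (hdet : p * t - q * r = 1)
    (hA : A' = A ^ 2 * p ^ 2 + 2 * B * p * r + C * r ^ 2)
    (hB : B' = A ^ 2 * p * q + B * (p * t + q * r) + C * r * t)
    (hC : A' * C' = A ^ 2 * q ^ 2 + 2 * B * q * t + C * t ^ 2)
    (hw : (t * (w0 ^ 2 - C * v0 ^ 2) - q * (2 * A * w0 * v0 + 2 * B * v0 ^ 2)) % m = w1)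
    (hv : (p * (2 * A * w0 * v0 + 2 * B * v0 ^ 2) - r * (w0 ^ 2 - C * v0 ^ 2)) % m = v1)
    (hK1 : (|t| + |q|) * (1 + |C| + 2 * |A| + 2 * |B|) ≤ 2 ^ K)
    (hK2 : (|p| + |r|) * (1 + |C| + 2 * |A| + 2 * |B|) ≤ 2 ^ K)
    (hL : L' = 2 * L + K) :
    PellRep m A' B' C' w1 v1 L' := by
  obtain ⟨w, v, hf, hw0, hv0, hwL, hvL⟩ := h
  have hN : (2 : ℤ) ^ L' = (2 ^ L * 2 ^ L) * 2 ^ K := by rw [hL]; ring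
  have hN0 : (0 : ℤ) ≤ 2 ^ L * 2 ^ L := by positivity
  have hww : |w * w| ≤ 2 ^ L * 2 ^ L := by rw [abs_mul]; gcongr
  have hwv : |w * v| ≤ 2 ^ L * 2 ^ L := by rw [abs_mul]; gcongr
  have hvv : |v * v| ≤ 2 ^ L * 2 ^ L := by rw [abs_mul]; gcongr
  have hX : |w ^ 2 - C * v ^ 2| ≤ (2 ^ L * 2 ^ L) * (1 + |C| + 2 * |A| + 2 * |B|) := by
    calc |w ^ 2 - C * v ^ 2| = |w * w - C * (v * v)| := by ring_nf
      _ ≤ |w * w| + |C * (v * v)| := abs_sub _ _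
      _ = |w * w| + |C| * |v * v| := by rw [abs_mul C]
      _ ≤ (2 ^ L * 2 ^ L) + |C| * (2 ^ L * 2 ^ L) := by gcongr
      _ ≤ _ := by nlinarith [mul_nonneg hN0 (abs_nonneg A), mul_nonneg hN0 (abs_nonneg B)]
  have hY : |2 * A * w * v + 2 * B * v ^ 2| ≤
      (2 ^ L * 2 ^ L) * (1 + |C| + 2 * |A| + 2 * |B|) := by
    calc |2 * A * w * v + 2 * B * v ^ 2| = |2 * A * (w * v) + 2 * B * (v * v)| := by ring_nf
      _ ≤ |2 * A * (w * v)| + |2 * B * (v * v)| := abs_add_le _ _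
      _ = 2 * |A| * |w * v| + 2 * |B| * |v * v| := by
        rw [abs_mul (2 * A), abs_mul (2 * B), abs_mul 2 A, abs_mul 2 B, abs_two]
      _ ≤ 2 * |A| * (2 ^ L * 2 ^ L) + 2 * |B| * (2 ^ L * 2 ^ L) := by gcongr
      _ ≤ _ := by nlinarith [mul_nonneg hN0 (abs_nonneg C)]
  have hXm : w ^ 2 - C * v ^ 2 ≡ w0 ^ 2 - C * v0 ^ 2 [ZMOD m] :=
    (hw0.pow 2).sub ((hv0.pow 2).mul_left C)
  have hYm : 2 * A * w * v + 2 * B * v ^ 2 ≡ 2 * A * w0 * v0 + 2 * B * v0 ^ 2 [ZMOD m] :=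
    ((hw0.mul_left (2 * A)).mul hv0).add ((hv0.pow 2).mul_left (2 * B))
  have hXY : A ^ 2 * (w ^ 2 - C * v ^ 2) ^ 2 +
      2 * B * (w ^ 2 - C * v ^ 2) * (2 * A * w * v + 2 * B * v ^ 2) +
      C * (2 * A * w * v + 2 * B * v ^ 2) ^ 2 = 1 := by
    have : (A * w ^ 2 + 2 * B * w * v + A * C * v ^ 2) ^ 2 = 1 := by rw [hf]; norm_num
    rw [← this]; ring
  generalize w ^ 2 - C * v ^ 2 = X at *
  generalize 2 * A * w * v + 2 * B * v ^ 2 = Y at *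
  refine ⟨t * X - q * Y, p * Y - r * X, ?_, ?_, ?_, ?_, ?_⟩
  · rw [hC, hA, hB, ← hXY]
    have h1 : p * (t * X - q * Y) + q * (p * Y - r * X) = X := by
      linear_combination X * hdet
    have h2 : r * (t * X - q * Y) + t * (p * Y - r * X) = Y := by
      linear_combination Y * hdet
    conv_rhs => rw [← h1, ← h2]
    ring
  · rw [← hw]
    exact ((hXm.mul_left t).sub (hYm.mul_left q)).trans (Int.mod_modEq _ _).symm
  · rw [← hv]
    exact ((hYm.mul_left p).sub (hXm.mul_left r)).trans (Int.mod_modEq _ _).symm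
  · rw [hN]; exact bound_aux _ _ _ _ _ _ _ hX hY hN0 hK1
  · rw [hN]; exact bound_aux _ _ _ _ _ _ _ hY hX hN0 hK2

/-- A nontrivial solution, obtained from a compact representation (infrastructure method). -/
lemma rep_final : PellRep (39028039587479 ^ 2) 1 0 (-39028039587479) 1523187874041827992493575440
    580547255185113469935158274 46614218 := by
  have h0 : PellRep (39028039587479 ^ 2) 1 0 (-39028039587479) 1 0 0 :=
    ⟨1, 0, by norm_num, rfl, rfl, by norm_num, by norm_num⟩
  have h1 := h0.step 6137233 30948058819201 25428550451498 (-24789058473) (-125003089312684697) 3968 20009322215 20009322215 1523187874041827992493571473 102 102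
    (by norm_num) (by norm_num) (by norm_num) (by norm_num) (by norm_num) (by norm_num)
    (by norm_num) (by norm_num) (by norm_num)
  have h2 := h1.step 1820057 363604177792 39910553465 1571 313841941 (-1912) (-381964221) 1523187874014200210401969060 138295996664 76 280
    (by norm_num) (by norm_num) (by norm_num) (by norm_num) (by norm_num) (by norm_num)
    (by norm_num) (by norm_num) (by norm_num)
  have h3 := h2.step 2561821 4941146339563 3720127887890 931 1795680911 (-8482) (-16359791071) 228250044974211660468736572 1517415666292509136430885491 74 634
    (by norm_num) (by norm_num) (by norm_num) (by norm_num) (by norm_num) (by norm_num)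
    (by norm_num) (by norm_num) (by norm_num)
  have h4 := h3.step 5931769 25627591199566 18665821799357 (-847) (-3659374239) 1125 4860443942 285911110666247654805514772 1117012155062687816708838943 77 1345
    (by norm_num) (by norm_num) (by norm_num) (by norm_num) (by norm_num) (by norm_num)
    (by norm_num) (by norm_num) (by norm_num)
  have h5 := h4.step (-2869759) (-3425938252700) 1425175045241 1354 1616413139 (-1859) (-2219285100) 342370801521382705483075796 376078151065323411483941798 78 2768
    (by norm_num) (by norm_num) (by norm_num) (by norm_num) (by norm_num) (by norm_num)
    (by norm_num) (by norm_num) (by norm_num)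
  have h6 := h5.step 4954541 16162194275691 10641278079442 (-1810) (-5904398259) (-4351) (-14193390511) 730594376182001841546632273 209518237919031133605224516 78 5614
    (by norm_num) (by norm_num) (by norm_num) (by norm_num) (by norm_num) (by norm_num)
    (by norm_num) (by norm_num) (by norm_num)
  have h7 := h6.step 3734009 12207060824051 10687386026162 (-983) (-3213578754) 1493 4880847487 1515589418687768516669618874 1238605692006522779089728096 79 11307
    (by norm_num) (by norm_num) (by norm_num) (by norm_num) (by norm_num) (by norm_num)
    (by norm_num) (by norm_num) (by norm_num)
  have h8 := h7.step (-1671191) (-1202470493508) 517722071785 1723 1239742651 (-1968) (-1416026429) 342972401921756491537588829 647075656687246587991774244 77 22691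
    (by norm_num) (by norm_num) (by norm_num) (by norm_num) (by norm_num) (by norm_num)
    (by norm_num) (by norm_num) (by norm_num)
  have h9 := h8.step 613969 202640944867 108933514610 31 10232545 72 23765911 1268097323128088702199984367 336841289122604165408966422 67 45449
    (by norm_num) (by norm_num) (by norm_num) (by norm_num) (by norm_num) (by norm_num)
    (by norm_num) (by norm_num) (by norm_num)
  have h10 := h9.step (-2987947) (-3482123979623) 1358134183850 93 108381320 (-173) (-201612563) 1410086679984457629048060927 290366211292974380154644051 68 90966
    (by norm_num) (by norm_num) (by norm_num) (by norm_num) (by norm_num) (by norm_num)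
    (by norm_num) (by norm_num) (by norm_num)
  have h11 := h10.step (-10021315) (-98399929008473) 96414009329930 (-759) (-7452668950) (-1946) (-19107896939) 372031412488716861643278987 1007391797807619892008927262 78 182010
    (by norm_num) (by norm_num) (by norm_num) (by norm_num) (by norm_num) (by norm_num)
    (by norm_num) (by norm_num) (by norm_num)
  have h12 := h11.step 5655625 3626999323598 411276351389 (-1505) (-965164559) (-1536) (-985045025) 188644342517111279271490828 123680222494923795453649958 79 364099
    (by norm_num) (by norm_num) (by norm_num) (by norm_num) (by norm_num) (by norm_num)
    (by norm_num) (by norm_num) (by norm_num)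
  have h13 := h12.step (-2323175) (-1160747806098) 249638688253 (-1187) (-593074132) 10468 5230244325 1149552678513447171532259467 1028418450396403497885613096 76 728274
    (by norm_num) (by norm_num) (by norm_num) (by norm_num) (by norm_num) (by norm_num)
    (by norm_num) (by norm_num) (by norm_num)
  have h14 := h13.step (-4645271) (-3998871381876) 741058957417 2709 2332033090 12596 10843222149 1301788505746455285227281857 1004306534436125232539976184 75 1456623
    (by norm_num) (by norm_num) (by norm_num) (by norm_num) (by norm_num) (by norm_num)
    (by norm_num) (by norm_num) (by norm_num)
  have h15 := h14.step 9533885 22915001451098 5776967975525 53 127386936 286 687408749 141342600374842611769508848 433724533325401635100955337 73 2913319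
    (by norm_num) (by norm_num) (by norm_num) (by norm_num) (by norm_num) (by norm_num)
    (by norm_num) (by norm_num) (by norm_num)
  have h16 := h15.step 9902677 28945875165332 8544135795905 1228 3589486351 (-4871) (-14238100990) 1357188002476486791922557599 932060726232467290842486291 80 5826718
    (by norm_num) (by norm_num) (by norm_num) (by norm_num) (by norm_num) (by norm_num)
    (by norm_num) (by norm_num) (by norm_num)
  have h17 := h16.step (-9137411) (-14353139) 2 (-1591) (-2001) 5390 6779 373941011760210033721494843 1219442483283265424068626396 60 11653496
    (by norm_num) (by norm_num) (by norm_num) (by norm_num) (by norm_num) (by norm_num)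
    (by norm_num) (by norm_num) (by norm_num)
  have h18 := h17.step (-9737699) (-24508194890822) 6334465255205 1 2516837 10300190 25923899299031 1302540230363173236007904978 1194101322613496926290325274 71 23307063
    (by norm_num) (by norm_num) (by norm_num) (by norm_num) (by norm_num) (by norm_num)
    (by norm_num) (by norm_num) (by norm_num)
  have h19 := h18.step 1 0 (-39028039587479) (-1614682) (-10087310109199) (-6247241) (-39028029849780) 1523187874041827992493575440 580547255185113469935158274 92 46614218
    (by norm_num) (by norm_num) (by norm_num) (by norm_num) (by norm_num) (by norm_num)
    (by norm_num) (by norm_num) (by norm_num)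
  exact h19

lemma prime_d : Nat.Prime 39028039587479 := by
  have hfac : (39028039587479 - 1 : ℕ) = 2 * 421 * 3187 * 3617 * 4021 := by norm_num
  apply lucas_primality 39028039587479 (13 : ZMod 39028039587479)
  · have e : (39028039587479 - 1 : ℕ) = 39028039587478 := by norm_num only
    rw [e]
    reduce_mod_char
  · intro q hq hdvd
    have hq' : q = 2 ∨ q = 421 ∨ q = 3187 ∨ q = 3617 ∨ q = 4021 := by
      rw [hfac] at hdvd
      have e : ∀ r : ℕ, r.Prime → q ∣ r → q = r := fun r hr h =>
        (Nat.prime_dvd_prime_iff_eq hq hr).1 h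
      rcases hq.dvd_mul.1 hdvd with h | h
      · rcases hq.dvd_mul.1 h with h | h
        · rcases hq.dvd_mul.1 h with h | h
          · rcases hq.dvd_mul.1 h with h | h
            · have := e 2 (by norm_num) h
              tauto
            · have := e 421 (by norm_num) h
              tauto
          · have := e 3187 (by norm_num) h
            tauto
        · have := e 3617 (by norm_num) h
          tauto
      · have := e 4021 (by norm_num) h
        tauto
    have key : ∀ c : ℕ, c % 39028039587479 ≠ 1 → (c : ZMod 39028039587479) ≠ ((1 : ℕ) : ZMod 39028039587479) := by
      intro c hc h
      rw [ZMod.natCast_eq_natCast_iff'] at h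
      exact hc (h.trans (by norm_num))
    rcases hq' with rfl | rfl | rfl | rfl | rfl
    · have e : ((39028039587479 - 1) / 2 : ℕ) = 19514019793739 := by norm_num only
      rw [e]
      reduce_mod_char
      exact_mod_cast key 39028039587478 (by norm_num)
    · have e : ((39028039587479 - 1) / 421 : ℕ) = 92703181918 := by norm_num only
      rw [e]
      reduce_mod_char
      exact_mod_cast key 21998654716238 (by norm_num)
    · have e : ((39028039587479 - 1) / 3187 : ℕ) = 12246011794 := by norm_num only
      rw [e]
      reduce_mod_char
      exact_mod_cast key 27265201336215 (by norm_num)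
    · have e : ((39028039587479 - 1) / 3617 : ℕ) = 10790168534 := by norm_num only
      rw [e]
      reduce_mod_char
      exact_mod_cast key 23144162197652 (by norm_num)
    · have e : ((39028039587479 - 1) / 4021 : ℕ) = 9706053118 := by norm_num only
      rw [e]
      reduce_mod_char
      exact_mod_cast key 23854836134359 (by norm_num)

section
variable {d : ℤ} (a : Pell.Solution₁ d)

lemma x_pow_modEq (n : ℕ) : (a ^ n).x ≡ a.x ^ n [ZMOD d] := by
  induction n with
  | zero => simp [Int.ModEq.refl]
  | succ n ih =>
    rw [pow_succ, Pell.Solution₁.x_mul, pow_succ]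
    have h : d * ((a ^ n).y * a.y) ≡ 0 [ZMOD d] :=
      Int.modEq_zero_iff_dvd.2 (dvd_mul_right _ _)
    simpa using (ih.mul_right a.x).add h

lemma y_pow_modEq (n : ℕ) : (a ^ n).y * a.x ≡ n * a.x ^ n * a.y [ZMOD d] := by
  induction n with
  | zero => simp [Int.ModEq.refl]
  | succ n ih =>
    rw [pow_succ, Pell.Solution₁.y_mul]
    have h1 := ((x_pow_modEq a n).mul_right (a.y * a.x)).add (ih.mul_right a.x)
    convert h1 using 1
    · ring
    · push_cast; ring

lemma two_pow_le (hd : 0 ≤ d) (hx : 2 ≤ a.x) (hy : 0 ≤ a.y) (n : ℕ) :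
    2 ^ n ≤ (a ^ n).x ∧ 0 ≤ (a ^ n).y := by
  induction n with
  | zero => simp
  | succ n ih =>
    obtain ⟨h1, h2⟩ := ih
    have h0 : (0 : ℤ) < 2 ^ n := by positivity
    have h3 : 0 ≤ d * ((a ^ n).y * a.y) := by positivity
    rw [pow_succ, pow_succ, Pell.Solution₁.x_mul, Pell.Solution₁.y_mul]
    constructor
    · nlinarith
    · have : 0 ≤ (a ^ n).x := by linarith
      have : 0 ≤ a.x := by linarith
      positivity

end

lemma dvd_of_pow (p : ℕ) (hp : p.Prime) (a : Pell.Solution₁ (p : ℤ)) (hx : 1 < a.x)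
    (hy : 0 < a.y) (n L : ℕ) (hn : n ≠ 0) (hL : (a ^ n).x ≤ 2 ^ L) (hLp : L < p)
    (hdvd : (p : ℤ) ∣ (a ^ n).y) : (p : ℤ) ∣ a.y := by
  have hpz : Prime (p : ℤ) := Nat.prime_iff_prime_int.1 hp
  have hnL : n ≤ L := by
    have := (two_pow_le a (by positivity) (by linarith) hy.le n).1.trans hL
    exact (pow_le_pow_iff_right₀ (by norm_num : (1 : ℤ) < 2)).1 this
  have hxp : ¬ (p : ℤ) ∣ a.x := by
    intro h
    have h1 : (p : ℤ) ∣ 1 := by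
      rw [← a.prop]
      exact dvd_sub (dvd_pow h two_ne_zero) (dvd_mul_right _ _)
    exact hpz.not_dvd_one h1
  have hnp : ¬ (p : ℤ) ∣ n := by
    intro h
    have := Nat.le_of_dvd (Nat.pos_of_ne_zero hn) (Int.natCast_dvd_natCast.1 h)
    omega
  have h := (y_pow_modEq a n).dvd_iff.1 (hdvd.mul_right _)
  rcases hpz.dvd_or_dvd h with h | h
  · rcases hpz.dvd_or_dvd h with h | h
    · exact absurd h hnp
    · exact absurd (hpz.dvd_of_dvd_pow h) hxp
  · exact h

lemma abs_x_y_zpow {d : ℤ} (a b : Pell.Solution₁ d)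
    (n : ℤ) (h : b = a ^ n ∨ b = -a ^ n) :
    (a ^ n.natAbs).x ≤ |b.x| ∧ ((a ^ n.natAbs).y = b.y ∨ (a ^ n.natAbs).y = -b.y) := by
  rcases Int.natAbs_eq n with hn | hn <;> rw [hn] at h <;> rcases h with h | h <;>
    simp only [zpow_neg, zpow_natCast] at h <;> subst h <;>
    simp [le_abs_self]

theorem mordell_counterexample :
    Nat.Prime 39028039587479 ∧ (39028039587479 : ℤ) % 4 = 3 ∧
      ∀ a : Pell.Solution₁ (39028039587479 : ℤ), Pell.IsFundamental a →
        (39028039587479 : ℤ) ∣ a.y := by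
  refine ⟨prime_d, by norm_num, ?_⟩
  intro a ha
  obtain ⟨x, y, hxy, -, hy, hxL, -⟩ := rep_final
  have hb : x ^ 2 - 39028039587479 * y ^ 2 = 1 := by linarith
  have hy0 : y ≠ 0 := by
    rintro rfl
    have := hy.dvd
    norm_num at this
  have hyd : (39028039587479 : ℤ) ∣ y := by
    have h2 : y ≡ 580547255185113469935158274 [ZMOD 39028039587479] := hy.of_mul_left 39028039587479
    exact (h2.dvd_iff).2 (by norm_num)
  let b : Pell.Solution₁ (39028039587479 : ℤ) := Pell.Solution₁.mk x y hb
  have hbx : b.x = x := rfl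
  have hby : b.y = y := rfl
  obtain ⟨n, hn⟩ := ha.eq_zpow_or_neg_zpow b
  obtain ⟨h1, h2⟩ := abs_x_y_zpow a b n hn
  rw [hbx] at h1
  rw [hby] at h2
  refine dvd_of_pow 39028039587479 prime_d a ha.1 ha.2.1 n.natAbs 46614218 ?_ (h1.trans hxL)
    (by norm_num) ?_
  · intro h0
    rw [h0] at h2
    simp at h2
    omega
  · rcases h2 with h2 | h2 <;> rw [h2]
    · exact hyd
    · exact (dvd_neg.2 hyd)
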